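/- The series ∑_{n=0}^∞ ((1/2)_n)^3/((1)_n^3) · (6n+1) · (1/4)^n equals 4/π. -/

import Mathlib

open Real

noncomputable def poch (a : ℝ) (n : ℕ) : ℝ := (ascPochhammer ℝ n).eval a

/-- The hypergeometric term of the WZ family. -/
noncomputable def tt (k : ℕ) : ℕ → ℝ
  | 0 => 1
  | (n+1) => tt k n * (((n:ℝ)+1/2)^3 / (4 * ((n:ℝ)+1) * ((n:ℝ)+1+k)^2))

lemma tt_succ (k n : ℕ) :
    tt k (n+1) = tt k n * (((n:ℝ)+1/2)^3 / (4 * ((n:ℝ)+1) * ((n:ℝ)+1+k)^2)) := rfl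

lemma tt_nonneg (k n : ℕ) : 0 ≤ tt k n := by
  induction n with
  | zero => simp [tt]
  | succ n ih => rw [tt_succ]; positivity

lemma ratio_le (k n : ℕ) :
    ((n:ℝ)+1/2)^3 / (4 * ((n:ℝ)+1) * ((n:ℝ)+1+k)^2) ≤ 1/4 := by
  have hn : (0:ℝ) ≤ n := n.cast_nonneg
  have hk : (0:ℝ) ≤ k := k.cast_nonneg
  rw [div_le_div_iff₀ (by positivity) (by norm_num)]
  have h1 : ((n:ℝ)+1/2)^3 ≤ ((n:ℝ)+1)^3 := by gcongr; norm_num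
  have h2 : ((n:ℝ)+1)^2 ≤ ((n:ℝ)+1+k)^2 :=
    pow_le_pow_left₀ (by positivity) (by linarith) 2
  have h3 : ((n:ℝ)+1) * ((n:ℝ)+1)^2 ≤ ((n:ℝ)+1) * ((n:ℝ)+1+k)^2 := by gcongr
  nlinarith

lemma tt_le (k n : ℕ) : tt k n ≤ (1/4:ℝ)^n := by
  induction n with
  | zero => simp [tt]
  | succ n ih =>
    rw [tt_succ, pow_succ]
    exact mul_le_mul ih (ratio_le k n) (by positivity) (pow_nonneg (by norm_num) n)

lemma tt_le' (k n : ℕ) : tt k (n+1) * ((k:ℝ)+1) ≤ (1/4:ℝ)^(n+1) := by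
  have hk : (0:ℝ) ≤ k := k.cast_nonneg
  induction n with
  | zero =>
    simp only [tt, Nat.cast_zero]
    rw [one_mul, div_mul_eq_mul_div, div_le_iff₀ (by positivity)]
    nlinarith
  | succ n ih =>
    rw [tt_succ, pow_succ, mul_right_comm]
    exact mul_le_mul ih (ratio_le k (n+1)) (by positivity) (pow_nonneg (by norm_num) (n+1))

lemma tt_shift (k n : ℕ) : tt (k+1) n = tt k n * (((k:ℝ)+1)^2 / ((n:ℝ)+1+k)^2) := by
  induction n with
  | zero =>
    have : (k:ℝ)+1 ≠ 0 := by positivity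
    simp only [tt, Nat.cast_zero]
    field_simp
    ring
  | succ n ih =>
    rw [tt_succ, tt_succ, ih]
    have h1 : (n:ℝ)+1+k ≠ 0 := by positivity
    have h2 : (n:ℝ)+1+1+k ≠ 0 := by positivity
    have h3 : (n:ℝ)+1+(k+1) ≠ 0 := by positivity
    push_cast
    field_simp
    ring

lemma sum_lin (a b : ℝ) : Summable fun n : ℕ => (1/4:ℝ)^n * (a * n + b) := by
  have h1 := summable_pow_mul_geometric_of_norm_lt_one (R := ℝ) 1 (r := 1/4) (by norm_num)
  have h0 := summable_geometric_of_norm_lt_one (x := (1/4:ℝ)) (by norm_num)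
  refine ((h1.mul_left a).add (h0.mul_left b)).congr fun n => ?_
  ring

lemma summ (k : ℕ) (a b : ℝ) (ha : 0 ≤ a) (hb : 0 ≤ b) :
    Summable fun n : ℕ => tt k n * (a * n + b) := by
  refine Summable.of_nonneg_of_le (fun n => ?_) (fun n => ?_) (sum_lin a b)
  · have := tt_nonneg k n; positivity
  · exact mul_le_mul_of_nonneg_right (tt_le k n) (by positivity)

noncomputable def SS (k : ℕ) : ℝ := ∑' n : ℕ, tt k n * (6 * n + (1 + 4 * k))

lemma SS_summable (k : ℕ) : Summable fun n : ℕ => tt k n * (6 * (n:ℝ) + (1 + 4 * k)) :=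
  summ k 6 _ (by norm_num) (by positivity)

lemma wz (k n : ℕ) :
    tt (k+1) n * (6 * n + (1 + 4 * ((k+1 : ℕ):ℝ))) * (((k:ℝ)+1/2)^2 / ((k:ℝ)+1)^2)
      - tt k n * (6 * n + (1 + 4 * k))
      = tt k (n+1) * (8 * ((n+1:ℕ):ℝ) + 0) - tt k n * (8 * n + 0) := by
  rw [tt_shift, tt_succ]
  have h1 : (n:ℝ)+1+k ≠ 0 := by positivity
  have h2 : (k:ℝ)+1 ≠ 0 := by positivity
  have h3 : (n:ℝ)+1 ≠ 0 := by positivity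
  push_cast
  field_simp
  ring

lemma SS_rec (k : ℕ) : SS (k+1) * (((k:ℝ)+1/2)^2 / ((k:ℝ)+1)^2) = SS k := by
  have hG := summ k 8 0 (by norm_num) le_rfl
  have hG' := (summable_nat_add_iff 1).2 hG
  have e := hG.tsum_eq_zero_add
  have h1 := (SS_summable (k+1)).mul_right (((k:ℝ)+1/2)^2 / ((k:ℝ)+1)^2)
  have h := h1.tsum_sub (SS_summable k)
  rw [tsum_congr (wz k), hG'.tsum_sub hG, tsum_mul_right] at h
  simp only [Nat.cast_zero, mul_zero, add_zero, zero_add] at e h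
  unfold SS
  linarith

lemma SS_wallis (k : ℕ) : SS k = SS 0 * Real.Wallis.W k * (2 * k + 1) := by
  induction k with
  | zero => simp [Real.Wallis.W]
  | succ k ih =>
    have h := SS_rec k
    rw [ih] at h
    rw [Real.Wallis.W_succ]
    have h2 : (k:ℝ)+1 ≠ 0 := by positivity
    have h3 : (k:ℝ)+1/2 ≠ 0 := by positivity
    have h4 : 2*(k:ℝ)+1 ≠ 0 := by positivity
    have h5 : 2*(k:ℝ)+3 ≠ 0 := by positivity
    rw [mul_div_assoc', div_eq_iff (by positivity)] at h
    have : SS (k+1) = SS 0 * Wallis.W k * (2 * k + 1) * ((k:ℝ)+1)^2 / ((k:ℝ)+1/2)^2 := by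
      rw [eq_div_iff (by positivity)]; exact h
    rw [this]
    push_cast
    field_simp
    ring

lemma SS_bound (k : ℕ) : 1 + 4 * (k:ℝ) ≤ SS k ∧
    SS k ≤ 1 + 4 * (k:ℝ) + ∑' n : ℕ, (1/4:ℝ)^n * (6 * n + 7) := by
  have hs := SS_summable k
  have e := hs.tsum_eq_zero_add
  have hs' := (summable_nat_add_iff 1).2 hs
  have h1 : 0 ≤ ∑' n : ℕ, tt k (n+1) * (6 * ((n+1:ℕ):ℝ) + (1 + 4 * k)) :=
    tsum_nonneg fun n => mul_nonneg (tt_nonneg _ _) (by positivity)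
  have h2 : ∑' n : ℕ, tt k (n+1) * (6 * ((n+1:ℕ):ℝ) + (1 + 4 * k)) ≤
      ∑' n : ℕ, (1/4:ℝ)^n * (6 * n + 7) := by
    refine hs'.tsum_le_tsum (fun n => ?_) (sum_lin 6 7)
    have a1 := tt_le' k n
    have a0 := tt_nonneg k (n+1)
    have hn : (0:ℝ) ≤ n := n.cast_nonneg
    have hk : (0:ℝ) ≤ k := k.cast_nonneg
    calc tt k (n+1) * (6 * ((n+1:ℕ):ℝ) + (1 + 4 * k))
        ≤ tt k (n+1) * (((k:ℝ)+1) * (6 * n + 7)) := by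
          apply mul_le_mul_of_nonneg_left _ a0
          push_cast
          nlinarith [mul_nonneg hn hk]
      _ = tt k (n+1) * ((k:ℝ)+1) * (6 * n + 7) := by ring
      _ ≤ (1/4:ℝ)^(n+1) * (6 * n + 7) := by gcongr
      _ ≤ (1/4:ℝ)^n * (6 * n + 7) := by
          apply mul_le_mul_of_nonneg_right _ (by positivity)
          rw [pow_succ]
          have : (0:ℝ) ≤ (1/4)^n := by positivity
          linarith
  have e0 : tt k 0 = 1 := rfl
  simp only [e0, Nat.cast_zero] at e
  unfold SS
  constructor <;> linarith

open Filter Topology in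
lemma lim_aux (c : ℝ) :
    Tendsto (fun k : ℕ => (1 + 4 * (k:ℝ) + c) / (2 * k + 1)) atTop (𝓝 2) := by
  have h : Tendsto (fun k : ℕ => 2 * (k:ℝ) + 1) atTop atTop :=
    tendsto_atTop_add_const_right _ _
      (tendsto_natCast_atTop_atTop.const_mul_atTop (by norm_num))
  have h2 := (h.const_div_atTop (c - 1)).const_add 2
  rw [add_zero] at h2
  refine h2.congr fun k => ?_
  have h4 : 2*(k:ℝ)+1 ≠ 0 := by positivity
  field_simp
  ring

open Filter Topology in
lemma SS_zero : SS 0 = 4 / π := by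
  have h1 : Tendsto (fun k : ℕ => SS k / (2 * k + 1)) atTop (𝓝 2) := by
    refine tendsto_of_tendsto_of_tendsto_of_le_of_le (lim_aux 0)
      (lim_aux (∑' n : ℕ, (1/4:ℝ)^n * (6 * n + 7)))
      (fun k => ?_) (fun k => ?_)
    · exact div_le_div_of_nonneg_right (by linarith [(SS_bound k).1]) (by positivity)
    · exact div_le_div_of_nonneg_right (SS_bound k).2 (by positivity)
  have h2 : Tendsto (fun k : ℕ => SS k / (2 * k + 1)) atTop (𝓝 (SS 0 * (π / 2))) := by
    refine (Real.Wallis.tendsto_W_nhds_pi_div_two.const_mul (SS 0)).congr fun k => ?_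
    have h4 : 2*(k:ℝ)+1 ≠ 0 := by positivity
    rw [SS_wallis k, mul_div_assoc, div_self h4, mul_one]
  have h := tendsto_nhds_unique h1 h2
  rw [eq_div_iff pi_ne_zero]
  linarith

lemma poch_succ (a : ℝ) (n : ℕ) : poch a (n+1) = poch a n * (a + n) := by
  simp [poch, ascPochhammer_succ_right]

lemma tt_eq (n : ℕ) : (poch (1/2) n * poch (1/2) n * poch (1/2) n) / (poch 1 n)^3 * ((1:ℝ)/4)^n
    = tt 0 n := by
  induction n with
  | zero => simp [poch, tt]
  | succ n ih =>
    rw [tt_succ, ← ih, poch_succ, poch_succ, pow_succ, mul_pow, Nat.cast_zero, add_zero]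
    have h3 : (n:ℝ)+1 ≠ 0 := by positivity
    have h4 : 1 + (n:ℝ) ≠ 0 := by positivity
    have h5 : poch 1 n ≠ 0 := (ascPochhammer_pos n (1:ℝ) one_pos).ne'
    rw [show 1 + (n:ℝ) = n + 1 by ring, show 1/2 + (n:ℝ) = n + 1/2 by ring]
    generalize (n:ℝ) + 1/2 = y
    field_simp
    rw [pow_succ]
    ring

theorem stmt_8 :
    ∑' n : ℕ, (poch (1/2) n * poch (1/2) n * poch (1/2) n) / (poch 1 n)^3 * (6*(n:ℝ)+1) * ((1:ℝ)/4)^n = 4 / π := by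
  rw [← SS_zero, SS]
  refine tsum_congr fun n => ?_
  rw [← tt_eq]
  simp only [Nat.cast_zero]
  ring
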